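/- Let ψ be differentiable on (0,∞) with ψ'(x) > 0 for all x > 0 and ψ' eventually non-increasing, and suppose a(z) := 1/ψ'(z) is regularly varying at infinity with index 1−τ for some τ ∈ (0,1]. Then for every ρ ≥ 0, ψ(r + a(r)ρ) − ψ(r) → ρ as r → ∞. Equivalently, for the density f(x) = C exp(−ψ(‖x‖)) one has f((r + a(r)ρ)θ)/f(rθ) → e^{−ρ} as r → ∞, for every unit vector θ. -/

import Mathlib

open MeasureTheory Filter Topology CategoryTheory AlgebraicTopology
open scoped InnerProductSpace ENNReal NNReal

noncomputable section

def ballsAround {d : ℕ} (Y : Set (EuclideanSpace ℝ (Fin d))) (r : ℝ) :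
    Set (EuclideanSpace ℝ (Fin d)) :=
  ⋃ y ∈ Y, Metric.ball y r

def cechBody {d : ℕ} (Y : Set (EuclideanSpace ℝ (Fin d))) (t : ℝ) :
    Set (EuclideanSpace ℝ (Fin d)) :=
  ballsAround Y (t / 2)

def cechConnected {d : ℕ} (Y : Set (EuclideanSpace ℝ (Fin d))) (t : ℝ) : Prop :=
  IsConnected (cechBody Y t)

def singularChainComplexQ (X : TopCat) : ChainComplex (ModuleCat ℚ) ℕ :=
  (alternatingFaceMapComplex (ModuleCat ℚ)).obj
    (((SimplicialObject.whiskering _ _).obj (ModuleCat.free ℚ)).obj (TopCat.toSSet.obj X))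

def bettiTop (X : TopCat) (k : ℕ) : ℕ :=
  Module.finrank ℚ ((singularChainComplexQ X).homology k)

def cechBetti {d : ℕ} (Y : Set (EuclideanSpace ℝ (Fin d))) (t : ℝ) (k : ℕ) : ℕ :=
  bettiTop (TopCat.of (cechBody Y t)) k

/-- `h_t^{(i,j)}(0, y₁, …, y_{m})` as a proposition: the Čech complex on the point set
`{0, y₁, …, y_m}` with parameter `t` is connected and its `k`-th Betti number is `j`. -/
def hProp {d : ℕ} (k : ℕ) (t : ℝ) (j : ℕ) {m : ℕ}
    (y : Fin m → EuclideanSpace ℝ (Fin d)) : Prop :=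
  cechConnected (insert 0 (Set.range y)) t ∧ cechBetti (insert 0 (Set.range y)) t k = j

/-- The random point set `{X_1(ω), …, X_n(ω)}`. -/
def pointCloud {Ω : Type*} {d : ℕ} (X : ℕ → Ω → EuclideanSpace ℝ (Fin d)) (n : ℕ) (ω : Ω) :
    Set (EuclideanSpace ℝ (Fin d)) :=
  {p | ∃ i < n, X i ω = p}

/-- The Betti number process `β_{k,n}(t)`: the `k`-th Betti number of the Čech complex
with parameter `t` built over the points of `{X_1,…,X_n}` lying at distance at least
`R_n` from the origin. -/
def betaProcess {Ω : Type*} {d : ℕ} (X : ℕ → Ω → EuclideanSpace ℝ (Fin d)) (R : ℕ → ℝ)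
    (k n : ℕ) (t : ℝ) (ω : Ω) : ℕ :=
  cechBetti {p ∈ pointCloud X n ω | R n ≤ ‖p‖} t k

/-- `ω_d`, the volume of the unit ball in `ℝ^d`. -/
def unitBallVol (d : ℕ) : ℝ :=
  (volume (Metric.ball (0 : EuclideanSpace ℝ (Fin d)) 1)).toReal

/-- `s_{d-1}`, the surface area of the unit sphere in `ℝ^d`. -/
def sphereSurf (d : ℕ) : ℝ := d * unitBallVol d

/-- `μ_k^{(k+2,1)}(t;0)`. -/
def muSimple (d k : ℕ) (α t : ℝ) : ℝ :=
  sphereSurf d / (α * (k + 2) - d) *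
    (volume {y : Fin (k + 1) → EuclideanSpace ℝ (Fin d) | hProp k t 1 y}).toReal

open Classical in
/-- `μ_k^{(i,j)}(t;λ)`. -/
def muGen (d k : ℕ) (α : ℝ) (i j : ℕ) (t lam : ℝ) : ℝ :=
  sphereSurf d * ∫ ρ in Set.Ioi (1 : ℝ),
    ρ ^ ((d : ℝ) - 1 - α * i) *
      ∫ y : Fin (i - 1) → EuclideanSpace ℝ (Fin d),
        if hProp k t j y then
          Real.exp (-(lam * ρ ^ (-α) * t ^ d *
            (volume (ballsAround (insert 0 (Set.range y)) 1)).toReal))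
        else 0

/-- The number of `i`-point subsets `Y` of `A` such that `Č(Y,t)` is connected, has `k`-th
Betti number `j`, and is a connected component of `Č(A,t)`. -/
def Jcount {d : ℕ} (k : ℕ) (A : Set (EuclideanSpace ℝ (Fin d))) (t : ℝ) (i j : ℕ) : ℕ :=
  Set.ncard {Y : Finset (EuclideanSpace ℝ (Fin d)) |
    (Y : Set (EuclideanSpace ℝ (Fin d))) ⊆ A ∧ Y.card = i ∧
      cechConnected (Y : Set (EuclideanSpace ℝ (Fin d))) t ∧
      cechBetti (Y : Set (EuclideanSpace ℝ (Fin d))) t k = j ∧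
      Disjoint (cechBody (Y : Set (EuclideanSpace ℝ (Fin d))) t)
        (cechBody (A \ (Y : Set (EuclideanSpace ℝ (Fin d)))) t)}

/-- The number of `i`-point subsets `Y` of `A` such that `Č(Y,t)` is connected. -/
def Lcount {d : ℕ} (A : Set (EuclideanSpace ℝ (Fin d))) (t : ℝ) (i : ℕ) : ℕ :=
  Set.ncard {Y : Finset (EuclideanSpace ℝ (Fin d)) |
    (Y : Set (EuclideanSpace ℝ (Fin d))) ⊆ A ∧ Y.card = i ∧
      cechConnected (Y : Set (EuclideanSpace ℝ (Fin d))) t}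

/-- The left-continuous generalized inverse `ψ^←(x) = inf {y ≥ 0 : ψ(y) ≥ x}`. -/
def psiInv (ψ : ℝ → ℝ) (x : ℝ) : ℝ := sInf {y : ℝ | 0 ≤ y ∧ x ≤ ψ y}

/-- The surface measure on the unit sphere of `ℝ^d` (total mass `s_{d-1} = d ω_d`). -/
def sphereMeasure (d : ℕ) : Measure (Metric.sphere (0 : EuclideanSpace ℝ (Fin d)) 1) :=
  (volume : Measure (EuclideanSpace ℝ (Fin d))).toSphere

open Classical in
/-- `ξ_k^{(i,j)}(t;λ)`, with `cinv = c⁻¹ ∈ [0,∞)`. -/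
def xiGen (d k : ℕ) (cinv : ℝ) (i j : ℕ) (t lam : ℝ) : ℝ :=
  ∫ θ : Metric.sphere (0 : EuclideanSpace ℝ (Fin d)) 1,
    (∫ ρ in Set.Ioi (0 : ℝ),
      (∫ y : Fin (i - 1) → EuclideanSpace ℝ (Fin d),
        if hProp k t j y ∧ ∀ ℓ, 0 ≤ ρ + cinv * ⟪(θ : EuclideanSpace ℝ (Fin d)), y ℓ⟫_ℝ then
          Real.exp (-(ρ * i) - cinv * ∑ ℓ, ⟪(θ : EuclideanSpace ℝ (Fin d)), y ℓ⟫_ℝ) *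
            Real.exp (-(lam * Real.exp (-ρ) *
              ∫ z in ballsAround (insert 0 (Set.range y)) t,
                Real.exp (-(cinv * ⟪(θ : EuclideanSpace ℝ (Fin d)), z⟫_ℝ))))
        else 0))
    ∂(sphereMeasure d)

/-- `ξ_k^{(k+2,1)}(t;0)`. -/
def xiSimple (d k : ℕ) (cinv : ℝ) (t : ℝ) : ℝ := xiGen d k cinv (k + 2) 1 t 0


open Classical in
/-- `ζ'_i(t)`: the limiting constant in the exponential-tail connectivity lemma. -/
def zetaExp (d : ℕ) (cinv : ℝ) (i : ℕ) (t : ℝ) : ℝ :=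
  ∫ θ : Metric.sphere (0 : EuclideanSpace ℝ (Fin d)) 1,
    (∫ ρ in Set.Ioi (0 : ℝ),
      (∫ y : Fin (i - 1) → EuclideanSpace ℝ (Fin d),
        if cechConnected (insert 0 (Set.range y)) t ∧
            ∀ ℓ, 0 ≤ ρ + cinv * ⟪(θ : EuclideanSpace ℝ (Fin d)), y ℓ⟫_ℝ then
          Real.exp (-(ρ * i) - cinv * ∑ ℓ, ⟪(θ : EuclideanSpace ℝ (Fin d)), y ℓ⟫_ℝ)
        else 0))
  ∂(sphereMeasure d)

/-- `ζ_i(t)`: the limiting constant in the heavy-tail connectivity lemma. -/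
def zetaHeavy (d : ℕ) (α : ℝ) (i : ℕ) (t : ℝ) : ℝ :=
  sphereSurf d / (α * i - d) *
    (volume {y : Fin (i - 1) → EuclideanSpace ℝ (Fin d) |
      cechConnected (insert 0 (Set.range y)) t}).toReal

end


/-- A monotone function that grows under doubling by at most a factor `2 ^ p` is `O(r ^ p)`. -/
lemma exists_le_mul_rpow_of_doubling {f : ℝ → ℝ} {R p : ℝ} (hR : 0 < R) (hp : 0 ≤ p)
    (hfR : 0 ≤ f R) (hmono : MonotoneOn f (Set.Ici R))
    (hdouble : ∀ r ≥ R, f (r * 2) ≤ 2 ^ p * f r) :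
    ∃ K, ∀ r ≥ R, f r ≤ K * r ^ p := by
  have hpow : ∀ n : ℕ, R ≤ R * 2 ^ n := fun n =>
    le_mul_of_one_le_right hR.le (one_le_pow₀ one_le_two)
  have hiter : ∀ n : ℕ, f (R * 2 ^ n) ≤ ((2 : ℝ) ^ n) ^ p * f R := by
    intro n
    induction n with
    | zero => simp
    | succ n ih =>
      calc f (R * 2 ^ (n + 1)) = f (R * 2 ^ n * 2) := by ring_nf
        _ ≤ 2 ^ p * f (R * 2 ^ n) := hdouble _ (hpow n)
        _ ≤ 2 ^ p * (((2 : ℝ) ^ n) ^ p * f R) := by gcongr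
        _ = ((2 : ℝ) ^ (n + 1)) ^ p * f R := by
          rw [pow_succ, Real.mul_rpow (by positivity) (by norm_num)]; ring
  refine ⟨(2 / R) ^ p * f R, fun r hr => ?_⟩
  have hr0 : 0 < r := hR.trans_le hr
  obtain ⟨n, hn, hn'⟩ := exists_nat_pow_near ((one_le_div hR).2 hr) one_lt_two
  have hle : r ≤ R * 2 ^ (n + 1) := by
    rw [mul_comm]; exact ((div_lt_iff₀ hR).1 hn').le
  calc f r ≤ f (R * 2 ^ (n + 1)) := hmono hr (hpow _) hle
    _ ≤ ((2 : ℝ) ^ (n + 1)) ^ p * f R := hiter _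
    _ ≤ (2 / R * r) ^ p * f R := by
      gcongr
      calc (2 : ℝ) ^ (n + 1) = 2 * 2 ^ n := by ring
        _ ≤ 2 * (r / R) := by gcongr
        _ = 2 / R * r := by ring
    _ = (2 / R) ^ p * f R * r ^ p := by
      rw [Real.mul_rpow (by positivity) hr0.le]; ring

/-- An eventually monotone, positive, regularly varying function of index `1 - τ < 1` is
`o(r)` at infinity. -/
lemma eventually_le_mul_of_regularlyVarying {f : ℝ → ℝ} {τ x₀ : ℝ} (hτ0 : 0 < τ) (hτ1 : τ ≤ 1)
    (hx₀ : 0 < x₀) (hpos : ∀ x > 0, 0 < f x) (hmono : MonotoneOn f (Set.Ici x₀))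
    (hRV : Tendsto (fun r => f (r * 2) / f r) atTop (𝓝 (2 ^ (1 - τ)))) {ε : ℝ} (hε : 0 < ε) :
    ∀ᶠ r in atTop, f r ≤ ε * r := by
  have hlt : (2 : ℝ) ^ (1 - τ) < 2 ^ (1 - τ / 2) :=
    Real.rpow_lt_rpow_of_exponent_lt one_lt_two (by linarith)
  obtain ⟨R₁, hR₁⟩ := eventually_atTop.1 (hRV.eventually_lt_const hlt)
  have hR : 0 < max R₁ x₀ := hx₀.trans_le (le_max_right _ _)
  obtain ⟨K, hK⟩ := exists_le_mul_rpow_of_doubling (f := f) (p := 1 - τ / 2) hR (by linarith)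
    (hpos _ hR).le (hmono.mono (Set.Ici_subset_Ici.2 (le_max_right _ _))) (fun r hr =>
      ((div_lt_iff₀ (hpos r (hR.trans_le hr))).1 (hR₁ r ((le_max_left _ _).trans hr))).le)
  have hlim : Tendsto (fun r : ℝ => K * r ^ (-(τ / 2))) atTop (𝓝 0) := by
    simpa using (tendsto_rpow_neg_atTop (half_pos hτ0)).const_mul K
  filter_upwards [hlim.eventually_lt_const hε, eventually_ge_atTop (max R₁ x₀)] with r hr hrR
  have hr0 : 0 < r := hR.trans_le hrR
  calc f r ≤ K * r ^ (1 - τ / 2) := hK r hrR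
    _ = K * r ^ (-(τ / 2)) * r := by
      rw [sub_eq_neg_add, Real.rpow_add_one hr0.ne', mul_assoc]
    _ ≤ ε * r := by gcongr

/-- Mean value bounds for the increment of a function with antitone derivative. -/
lemma increment_mem_Icc_of_antitoneOn_deriv {ψ : ℝ → ℝ} {r h : ℝ} (hh : 0 ≤ h)
    (hdiff : ∀ x ≥ r, DifferentiableAt ℝ ψ x) (hanti : AntitoneOn (deriv ψ) (Set.Ici r)) :
    ψ (r + h) - ψ r ∈ Set.Icc (deriv ψ (r + h) * h) (deriv ψ r * h) := by
  rcases hh.eq_or_lt with rfl | hh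
  · simp
  obtain ⟨c, ⟨hrc, hch⟩, hc⟩ := exists_deriv_eq_slope ψ (lt_add_of_pos_right r hh)
    (fun x hx => (hdiff x hx.1).continuousAt.continuousWithinAt)
    (fun x hx => (hdiff x hx.1.le).differentiableWithinAt)
  rw [add_sub_cancel_left, eq_div_iff hh.ne'] at hc
  rw [← hc]
  exact ⟨mul_le_mul_of_nonneg_right (hanti hrc.le (by simpa using hh.le) hch.le) hh.le,
    mul_le_mul_of_nonneg_right (hanti Set.self_mem_Ici hrc.le hrc.le) hh.le⟩

/-- If `a = 1/ψ'` is regularly varying of index `1-τ`, then `ψ(r + a(r)ρ) - ψ(r) → ρ`;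
equivalently the density ratio `f((r+a(r)ρ)θ)/f(rθ)` tends to `e^{-ρ}`. -/
theorem stmt18 (τ : ℝ) (hτ0 : 0 < τ) (hτ1 : τ ≤ 1) (ψ : ℝ → ℝ)
    (hψdiff : ∀ x > (0:ℝ), DifferentiableAt ℝ ψ x)
    (hψ'pos : ∀ x > (0:ℝ), 0 < deriv ψ x)
    (hψ'mono : ∃ x₀ > (0:ℝ), AntitoneOn (deriv ψ) (Set.Ici x₀))
    (a : ℝ → ℝ) (ha : ∀ z, a z = (deriv ψ z)⁻¹)
    (haRV : ∀ s > (0:ℝ), Tendsto (fun r => a (r * s) / a r) atTop (𝓝 (s ^ (1 - τ)))) :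
    (∀ ρ ≥ (0:ℝ), Tendsto (fun r => ψ (r + a r * ρ) - ψ r) atTop (𝓝 ρ)) ∧
    ∀ C > (0:ℝ), ∀ ρ ≥ (0:ℝ),
      Tendsto (fun r => (C * Real.exp (-ψ (r + a r * ρ))) / (C * Real.exp (-ψ r)))
        atTop (𝓝 (Real.exp (-ρ))) := by
  obtain ⟨x₀, hx₀, hanti⟩ := hψ'mono
  have hapos : ∀ x > (0 : ℝ), 0 < a x := fun x hx => by
    rw [ha]; exact inv_pos.2 (hψ'pos x hx)
  have hderiv : ∀ x, deriv ψ x = (a x)⁻¹ := fun x => by rw [ha, inv_inv]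
  have hamono : MonotoneOn a (Set.Ici x₀) := fun x hx y hy hxy => by
    rw [ha, ha]
    exact inv_anti₀ (hψ'pos y (hx₀.trans_le hy)) (hanti hx hy hxy)
  have hlim : ∀ ρ ≥ (0 : ℝ), Tendsto (fun r => ψ (r + a r * ρ) - ψ r) atTop (𝓝 ρ) := by
    intro ρ hρ
    have hbounds : ∀ r ≥ x₀,
        ψ (r + a r * ρ) - ψ r ∈ Set.Icc (a r * ρ / a (r + a r * ρ)) ρ := by
      intro r hr
      have har : 0 < a r := hapos r (hx₀.trans_le hr)
      have h := increment_mem_Icc_of_antitoneOn_deriv (mul_nonneg har.le hρ)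
        (fun x hx => hψdiff x (hx₀.trans_le (hr.trans hx)))
        (hanti.mono (Set.Ici_subset_Ici.2 hr))
      rwa [hderiv, hderiv, inv_mul_cancel_left₀ har.ne', inv_mul_eq_div] at h
    refine tendsto_order.2 ⟨fun l hl => ?_, fun u hu => ?_⟩
    · obtain ⟨δ, hδ, hlδ⟩ : ∃ δ > 0, l < ρ / (1 + δ) := by
        have hc : ContinuousAt (fun δ : ℝ => ρ / (1 + δ)) 0 := by
          fun_prop (disch := norm_num)
        have hev : ∀ᶠ δ in 𝓝[>] (0 : ℝ), l < ρ / (1 + δ) :=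
          nhdsWithin_le_nhds (hc.eventually_const_lt (by simpa using hl))
        exact (eventually_mem_nhdsWithin.and hev).exists
      have hlt : (1 + δ) ^ (1 - τ) < 1 + δ :=
        Real.rpow_lt_self_of_one_lt (by linarith) (by linarith)
      filter_upwards [(haRV (1 + δ) (by positivity)).eventually_lt_const hlt,
        eventually_le_mul_of_regularlyVarying hτ0 hτ1 hx₀ hapos hamono (haRV 2 two_pos)
          (show 0 < δ / (ρ + 1) by positivity),
        eventually_ge_atTop x₀] with r hr hlittle hrx
      have hr0 : 0 < r := hx₀.trans_le hrx
      have har : 0 < a r := hapos r hr0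
      have hstep : r + a r * ρ ≤ r * (1 + δ) := by
        have h1 : a r * (ρ + 1) ≤ δ * r := by
          rwa [div_mul_eq_mul_div, le_div_iff₀ (by positivity)] at hlittle
        linarith
      have hle : x₀ ≤ r + a r * ρ := by nlinarith
      have hpos : 0 < a (r + a r * ρ) := hapos _ (hx₀.trans_le hle)
      have hbound : a (r + a r * ρ) ≤ (1 + δ) * a r :=
        (hamono hle (hle.trans hstep) hstep).trans ((div_lt_iff₀ har).1 hr).le
      calc l < ρ / (1 + δ) := hlδ
        _ = a r * ρ / ((1 + δ) * a r) := by field_simp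
        _ ≤ a r * ρ / a (r + a r * ρ) := by gcongr
        _ ≤ _ := (hbounds r hrx).1
    · filter_upwards [eventually_ge_atTop x₀] with r hr
      exact (hbounds r hr).2.trans_lt hu
  refine ⟨hlim, fun C hC ρ hρ => ?_⟩
  refine ((Real.continuous_exp.tendsto _).comp (hlim ρ hρ).neg).congr fun r => ?_
  rw [mul_div_mul_left _ _ hC.ne', ← Real.exp_sub, Function.comp_apply]
  ring_nf
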